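/- arXiv:1207.5314 — 3 statements merged into one kernel-verified Lean document; each statement's English description precedes it below -/
import Mathlib

section
/- For all dominant elements λ, μ ∈ X₊, one has λ ≤ μ if and only if both λ ⪯ μ and μ − λ ∈ Q. In other words, for dominant λ, μ the dominance order λ ≤ μ holds exactly when μ − λ is a nonnegative real combination of simple roots and λ, μ have the same image in X/Q. -/
open scoped TensorProduct

/-- A root datum `(X, R, X^∨, R^∨)` together with a fixed system of positive roots
`R₊` and corresponding simple roots `Δ`.  The pairing `pair` is the perfect pairing
`⟨-,-⟩ : X × X^∨ → ℤ`, and `coroot` realizes the bijection `R → R^∨`, `α ↦ α^∨`. -/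
structure RootDatumBase (X Xv : Type) [AddCommGroup X] [AddCommGroup Xv] where
  /-- the perfect pairing `⟨-,-⟩ : X × X^∨ → ℤ` -/
  pair : X →ₗ[ℤ] Xv →ₗ[ℤ] ℤ
  perfect_left : Function.Bijective pair
  perfect_right : Function.Bijective pair.flip
  /-- the (finite) set of roots `R ⊆ X` -/
  R : Finset X
  /-- the set of coroots `R^∨ ⊆ X^∨` -/
  Rv : Finset Xv
  /-- the coroot map `α ↦ α^∨` -/
  coroot : X → Xv
  coroot_bijOn : Set.BijOn coroot ↑R ↑Rv
  pair_self : ∀ α ∈ R, pair α (coroot α) = 2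
  /-- the reflections `s_α (x) = x - ⟨x, α^∨⟩ α` preserve `R` -/
  reflect_mem : ∀ α ∈ R, ∀ β ∈ R, β - pair β (coroot α) • α ∈ R
  /-- the dual reflections preserve `R^∨` -/
  coreflect_mem : ∀ α ∈ R, ∀ γ ∈ Rv, γ - pair α γ • coroot α ∈ Rv
  /-- the root system is reduced -/
  reduced : ∀ α ∈ R, ∀ n : ℤ, n • α ∈ R → n = 1 ∨ n = -1
  /-- the system of positive roots `R₊` -/
  Rpos : Finset X
  Rpos_subset : Rpos ⊆ R
  pos_or_neg : ∀ α ∈ R, α ∈ Rpos ∨ -α ∈ Rpos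
  not_pos_and_neg : ∀ α ∈ Rpos, -α ∉ Rpos
  /-- the set of simple roots `Δ ⊆ R₊` -/
  Δ : Finset X
  Δ_subset : Δ ⊆ Rpos
  /-- every positive root is an `ℕ`-linear combination of simple roots -/
  pos_eq_nat_comb : ∀ α ∈ Rpos, ∃ c : X → ℕ, α = ∑ β ∈ Δ, c β • β
  /-- `⟨α, β^∨⟩ ≤ 0` for distinct simple roots `α, β` -/
  simple_obtuse : ∀ α ∈ Δ, ∀ β ∈ Δ, α ≠ β → pair α (coroot β) ≤ 0
  /-- the simple roots are linearly independent -/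
  simple_indep : LinearIndependent ℤ (fun a : {x // x ∈ Δ} => (a : X))

namespace RootDatumBase

variable {X Xv : Type} [AddCommGroup X] [AddCommGroup Xv] (D : RootDatumBase X Xv)

/-- the cone of dominant elements `X₊ = {μ ∈ X | ⟨μ, α^∨⟩ ≥ 0 ∀ α ∈ R₊}` -/
def Xplus : Set X := {μ : X | ∀ α ∈ D.Rpos, 0 ≤ D.pair μ (D.coroot α)}

/-- `Q₊`, the submonoid of `X` generated by the positive roots -/
def Qplus : AddSubmonoid X := AddSubmonoid.closure ↑D.Rpos

/-- `Q`, the subgroup of `X` generated by the roots -/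
def Qgrp : AddSubgroup X := AddSubgroup.closure ↑D.R

/-- the dominance order: `λ ≤ μ` iff `μ - λ ∈ Q₊` -/
def dle (l m : X) : Prop := m - l ∈ D.Qplus

/-- the canonical map `X → X ⊗ ℝ`, `x ↦ x ⊗ 1` -/
noncomputable def toReal (X : Type) [AddCommGroup X] : X →ₗ[ℤ] ℝ ⊗[ℤ] X :=
  TensorProduct.mk ℤ ℝ X 1

/-- the weak order: `λ ⪯ μ` iff `(μ - λ) ⊗ 1` is a nonnegative real combination of
the simple roots in `X ⊗ ℝ` -/
noncomputable def dpreceq (l m : X) : Prop :=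
  ∃ c : X → ℝ, (∀ β : X, 0 ≤ c β) ∧
    toReal X (m - l) = ∑ β ∈ D.Δ, c β • toReal X β

/-- the Weyl group `W ≤ Aut(X)`, generated by the reflections `s_α`, `α ∈ R` -/
def Weyl : Subgroup (X ≃ₗ[ℤ] X) :=
  Subgroup.closure {w : X ≃ₗ[ℤ] X | ∃ α ∈ D.R, ∀ x : X, w x = x - D.pair x (D.coroot α) • α}

/-- the Weyl group orbit `W ν` of `ν ∈ X` -/
def WOrbit (ν : X) : Set X := {x : X | ∃ w ∈ D.Weyl, x = w ν}

/-- `Conv(Wν)`, the convex hull in `X ⊗ ℝ` of the Weyl orbit of `ν ⊗ 1` -/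
noncomputable def ConvW (ν : X) : Set (ℝ ⊗[ℤ] X) :=
  convexHull ℝ (toReal X '' D.WOrbit ν)

end RootDatumBase

namespace RootDatumBase

theorem exists_nat_of_mem_Qplus {X Xv : Type} [AddCommGroup X] [AddCommGroup Xv]
    (D : RootDatumBase X Xv) (x : X) (hx : x ∈ D.Qplus) :
    ∃ c : X → ℕ, x = ∑ β ∈ D.Δ, c β • β := by
  induction hx using AddSubmonoid.closure_induction with
  | mem x hx => exact D.pos_eq_nat_comb x hx
  | zero => exact ⟨0, by simp⟩
  | add x y _ _ hx hy =>
    obtain ⟨c, hc⟩ := hx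
    obtain ⟨d, hd⟩ := hy
    exact ⟨c + d, by simp only [Pi.add_apply, add_smul, Finset.sum_add_distrib, ← hc, ← hd]⟩

theorem exists_int_of_mem_Qgrp {X Xv : Type} [AddCommGroup X] [AddCommGroup Xv]
    (D : RootDatumBase X Xv) (x : X) (hx : x ∈ D.Qgrp) :
    ∃ c : X → ℤ, x = ∑ β ∈ D.Δ, c β • β := by
  induction hx using AddSubgroup.closure_induction with
  | mem x hx =>
    rcases D.pos_or_neg x hx with h | h
    · obtain ⟨c, hc⟩ := D.pos_eq_nat_comb x h
      exact ⟨fun β => (c β : ℤ), by simpa using hc⟩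
    · obtain ⟨c, hc⟩ := D.pos_eq_nat_comb _ h
      exact ⟨fun β => -(c β : ℤ), by simp [← hc]⟩
  | zero => exact ⟨0, by simp⟩
  | add x y _ _ hx hy =>
    obtain ⟨c, hc⟩ := hx
    obtain ⟨d, hd⟩ := hy
    exact ⟨c + d, by simp only [Pi.add_apply, add_smul, Finset.sum_add_distrib, ← hc, ← hd]⟩
  | neg x _ hx =>
    obtain ⟨c, hc⟩ := hx
    exact ⟨-c, by simp only [Pi.neg_apply, neg_smul, Finset.sum_neg_distrib, ← hc]⟩

theorem toReal_sum {X : Type} [AddCommGroup X] (s : Finset X) (c : X → ℤ) :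
    toReal X (∑ β ∈ s, c β • β) = ∑ β ∈ s, (c β : ℝ) • toReal X β := by
  simp only [map_sum, map_smul, Int.cast_smul_eq_zsmul]

end RootDatumBase

/-- Lemma B.2. For dominant `λ, μ ∈ X₊`: `λ ≤ μ` iff `λ ⪯ μ` and
`μ - λ ∈ Q`, i.e. the dominance order holds exactly when `μ - λ` is a nonnegative
real combination of simple roots and `λ, μ` have the same image in `X/Q`. -/
theorem dominance_iff_weak_and_rootLattice
    {X Xv : Type} [AddCommGroup X] [AddCommGroup Xv]
    [Module.Free ℤ X] [Module.Finite ℤ X]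
    (D : RootDatumBase X Xv)
    (l m : X) (hl : l ∈ D.Xplus) (hm : m ∈ D.Xplus) :
    D.dle l m ↔ (D.dpreceq l m ∧ m - l ∈ D.Qgrp) := by
  constructor
  · intro h
    refine ⟨?_, ?_⟩
    · obtain ⟨c, hc⟩ := D.exists_nat_of_mem_Qplus _ h
      refine ⟨fun β => (c β : ℝ), fun β => Nat.cast_nonneg _, ?_⟩
      have := RootDatumBase.toReal_sum D.Δ (fun β => (c β : ℤ))
      simp only [natCast_zsmul, ← hc, Int.cast_natCast] at this
      exact this
    · have hle : D.Qplus ≤ D.Qgrp.toAddSubmonoid :=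
        (AddSubmonoid.closure_le).2 fun x hx =>
          AddSubgroup.subset_closure (D.Rpos_subset hx)
      exact hle h
  · rintro ⟨⟨c, hc0, hc⟩, hQ⟩
    obtain ⟨z, hz⟩ := D.exists_int_of_mem_Qgrp _ hQ
    have hli : LinearIndependent ℝ
        (fun a : {x // x ∈ D.Δ} => RootDatumBase.toReal X (a : X)) :=
      Module.Flat.linearIndependent_one_tmul (S := ℝ) D.simple_indep
    rw [hz, RootDatumBase.toReal_sum, ← Finset.sum_attach D.Δ,
      ← Finset.sum_attach D.Δ (fun β => c β • _)] at hc
    have key := linearIndependent_iff'ₛ.1 hli D.Δ.attach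
      (fun a => (z a : ℝ)) (fun a => c a) hc
    change m - l ∈ D.Qplus
    rw [hz]
    refine AddSubmonoid.sum_mem _ fun β hβ => ?_
    have h1 : (z β : ℝ) = c β := key ⟨β, hβ⟩ (Finset.mem_attach _ _)
    have h2 : 0 ≤ z β := by
      have := hc0 β
      rw [← h1] at this
      exact_mod_cast this
    obtain ⟨n, hn⟩ := Int.eq_ofNat_of_zero_le h2
    rw [hn, natCast_zsmul]
    exact AddSubmonoid.nsmul_mem _ (AddSubmonoid.subset_closure (D.Δ_subset hβ)) n
end

section
/- For all dominant elements λ, μ ∈ X₊: λ ⪯ μ if and only if Conv(Wλ) ⊆ Conv(Wμ), i.e. μ − λ is a nonnegative real combination of simple roots exactly when the convex hull of the Weyl orbit of λ is contained in the convex hull of the Weyl orbit of μ in X ⊗ ℝ. -/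
open scoped TensorProduct

namespace RootDatumBase

section helpers

variable {X Xv : Type} [AddCommGroup X] [AddCommGroup Xv] (D : RootDatumBase X Xv)

/-- reflection as a function -/
def sr (a x : X) : X := x - D.pair x (D.coroot a) • a

/-- the coroot of a reflected root, from the Mathlib theory of root pairings; also gives positivity of the
canonical form -/
theorem mathlib_facts [Module.Free ℤ X] [Module.Finite ℤ X] :
    (∀ a ∈ D.R, ∀ b ∈ D.R, D.coroot (D.sr b a) = D.coroot a - D.pair b (D.coroot a) • D.coroot b) ∧
    (∀ g ∈ D.Rpos, ∃ b ∈ D.Δ, 0 < D.pair g (D.coroot b)) ∧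
    (∀ x ∈ Submodule.span ℤ (D.R : Set X), (∀ g ∈ D.R, D.pair x (D.coroot g) = 0) → x = 0) := by
  classical
  have : D.pair.IsPerfPair := ⟨D.perfect_left, D.perfect_right⟩
  let rt : {x // x ∈ D.R} ↪ X := ⟨fun i => i.1, Subtype.val_injective⟩
  let crt : {x // x ∈ D.R} ↪ Xv := ⟨fun i => D.coroot i.1, fun i j h =>
    Subtype.ext (D.coroot_bijOn.injOn i.2 j.2 h)⟩
  have hr : ∀ i, Set.MapsTo (Module.preReflection (rt i) (D.pair.flip (crt i)))
      (Set.range rt) (Set.range rt) := by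
    rintro i - ⟨j, rfl⟩
    exact ⟨⟨_, D.reflect_mem i.1 i.2 j.1 j.2⟩, rfl⟩
  have hc : ∀ i, Set.MapsTo (Module.preReflection (crt i) (D.pair (rt i)))
      (Set.range crt) (Set.range crt) := by
    rintro i - ⟨j, rfl⟩
    have h := D.coreflect_mem i.1 i.2 _ (D.coroot_bijOn.mapsTo j.2)
    obtain ⟨k, hk, hk'⟩ := D.coroot_bijOn.surjOn h
    exact ⟨⟨k, hk⟩, hk'⟩
  let P : RootPairing {x // x ∈ D.R} ℤ X Xv :=
    RootPairing.mk' D.pair rt crt (fun i => D.pair_self i.1 i.2) hr hc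
  have hPr : ∀ i, P.root i = i.1 := fun i => rfl
  have hPc : ∀ i, P.coroot i = D.coroot i.1 := fun i => rfl
  have hPp : ∀ x y, P.toLinearMap x y = D.pair x y := fun x y => rfl
  have hspan : P.rootSpan ℤ = Submodule.span ℤ (D.R : Set X) := by
    unfold RootPairing.rootSpan
    congr 1
    ext x; constructor
    · rintro ⟨i, rfl⟩; exact i.2
    · intro hx; exact ⟨⟨x, hx⟩, rfl⟩
  have hself : ∀ g ∈ D.R, 0 < P.RootForm g g := by
    intro g hg
    refine P.rootForm_pos_of_ne_zero (hspan ▸ Submodule.subset_span hg) ?_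
    rintro rfl
    have := D.pair_self 0 hg
    simp at this
  refine ⟨?_, ?_, ?_⟩
  · intro a ha b hb
    have h1 := P.reflectionPerm_root ⟨b, hb⟩ ⟨a, ha⟩
    have h2 := P.reflectionPerm_coroot ⟨b, hb⟩ ⟨a, ha⟩
    simp only [hPr, hPc, hPp] at h1 h2
    unfold sr
    rw [h2]
    congr 1
  · intro g hg
    by_contra! hcon
    have hgR := D.Rpos_subset hg
    have hpos : 0 < P.RootForm g g := hself g hgR
    obtain ⟨c, hcs⟩ := D.pos_eq_nat_comb g hg
    have : P.RootForm g g = ∑ b ∈ D.Δ, (c b : ℤ) * P.RootForm g b := by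
      have h := congrArg (P.RootForm g) hcs
      rw [h, map_sum]
      exact Finset.sum_congr rfl fun b _ => by rw [map_nsmul, nsmul_eq_mul]
    have hle : ∀ b ∈ D.Δ, (c b : ℤ) * P.RootForm g b ≤ 0 := by
      intro b hb
      have hbR := D.Rpos_subset (D.Δ_subset hb)
      have h3 := P.rootForm_self_smul_coroot ⟨b, hbR⟩
      have h4 := congrArg (fun y => D.pair g y) h3
      have hbpos : 0 < P.RootForm b b := hself b hbR
      have h5 : D.pair g (P.Polarization b) = P.RootForm b g :=
        P.toLinearMap_apply_apply_Polarization b g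
      have h6 : P.RootForm b g = P.RootForm g b := P.rootForm_symmetric.eq b g
      simp only [hPr, hPc, map_smul, smul_eq_mul, map_nsmul, two_smul, map_add, h5, h6] at h4
      have h7 := hcon b hb
      have : P.RootForm g b ≤ 0 := by
        have := mul_nonpos_of_nonneg_of_nonpos hbpos.le h7
        have h8 : 2 * P.RootForm g b ≤ 0 := by
          refine le_trans (le_of_eq ?_) this
          rw [h4]; ring
        linarith
      exact mul_nonpos_of_nonneg_of_nonpos (by positivity) this
    have := Finset.sum_nonpos hle
    linarith
  · intro x hx h
    apply P.eq_zero_of_mem_rootSpan_of_rootForm_self_eq_zero (hspan ▸ hx)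
    rw [P.rootForm_apply_apply]
    apply Finset.sum_eq_zero
    intro i _
    have : P.coroot' i x = 0 := h i.1 i.2
    simp [this]

variable {D}

theorem Δ_R {b : X} (hb : b ∈ D.Δ) : b ∈ D.R := D.Rpos_subset (D.Δ_subset hb)

theorem sr_mem {a b : X} (ha : a ∈ D.R) (hb : b ∈ D.R) : D.sr a b ∈ D.R := D.reflect_mem a ha b hb

theorem sr_self {a : X} (ha : a ∈ D.R) : D.sr a a = -a := by
  simp only [sr, D.pair_self a ha]; rw [two_smul]; abel

theorem neg_mem_R {a : X} (ha : a ∈ D.R) : -a ∈ D.R := sr_self ha ▸ sr_mem ha ha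

theorem sr_sr {a : X} (ha : a ∈ D.R) (x : X) : D.sr a (D.sr a x) = x := by
  simp only [sr, map_sub, map_smul, LinearMap.sub_apply, LinearMap.smul_apply, D.pair_self a ha,
    smul_eq_mul]
  module

theorem sr_neg_right (a x : X) : D.sr a (-x) = - D.sr a x := by
  simp only [sr, map_neg, LinearMap.neg_apply]; module

section
variable [Module.Free ℤ X] [Module.Finite ℤ X]

theorem pair_sr {a b : X} (ha : a ∈ D.R) (hb : b ∈ D.R) (x : X) :
    D.pair (D.sr b x) (D.coroot a) = D.pair x (D.coroot (D.sr b a)) := by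
  rw [D.mathlib_facts.1 a ha b hb]
  simp only [sr, map_sub, map_smul, LinearMap.sub_apply, LinearMap.smul_apply, smul_eq_mul]
  ring

theorem sr_conj {a b : X} (ha : a ∈ D.R) (hb : b ∈ D.R) (x : X) :
    D.sr (D.sr b a) x = D.sr b (D.sr a (D.sr b x)) := by
  rw [sr, ← pair_sr ha hb, sr.eq_def D a]
  generalize D.pair (D.sr b x) (D.coroot a) = n
  conv_rhs => rw [sr]
  conv_lhs => rw [← sr_sr hb x]
  simp only [sr, map_sub, map_smul, LinearMap.sub_apply, LinearMap.smul_apply, smul_eq_mul]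
  module

theorem coroot_neg {a : X} (ha : a ∈ D.R) : D.coroot (-a) = - D.coroot a := by
  rw [← sr_self ha, D.mathlib_facts.1 a ha a ha, D.pair_self a ha]; module

theorem sr_neg_left {a : X} (ha : a ∈ D.R) (x : X) : D.sr (-a) x = D.sr a x := by
  simp only [sr, coroot_neg ha]; simp

end

theorem Δ_coeff_unique {c d : X → ℤ} (h : ∑ b ∈ D.Δ, c b • b = ∑ b ∈ D.Δ, d b • b) :
    ∀ b ∈ D.Δ, c b = d b := by
  have h0 : ∑ b ∈ D.Δ, (c b - d b) • b = 0 := by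
    simp only [sub_smul, Finset.sum_sub_distrib, h, sub_self]
  have hi := Fintype.linearIndependent_iff.mp D.simple_indep (fun a => c a.1 - d a.1) (by
    rw [← h0]; exact Finset.sum_coe_sort D.Δ (fun b => (c b - d b) • b))
  intro b hb
  have := hi ⟨b, hb⟩
  simpa [sub_eq_zero] using this

/-- a simple reflection permutes the other positive roots -/
theorem sr_pos {g b : X} (hg : g ∈ D.Rpos) (hb : b ∈ D.Δ) (hne : g ≠ b) : D.sr b g ∈ D.Rpos := by
  classical
  have hgR := D.Rpos_subset hg
  rcases D.pos_or_neg _ (sr_mem (Δ_R hb) hgR) with h | h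
  · exact h
  exfalso
  obtain ⟨c, hc⟩ := D.pos_eq_nat_comb g hg
  obtain ⟨d, hd⟩ := D.pos_eq_nat_comb _ h
  set n := D.pair g (D.coroot b) with hn
  have e1 : ∑ x ∈ D.Δ, (c x + d x : ℤ) • x = ∑ x ∈ D.Δ, (if x = b then n else 0) • x := by
    have : ∑ x ∈ D.Δ, (if x = b then n else 0) • x = n • b := by
      simp [ite_smul, hb]
    rw [this]
    simp only [add_smul, natCast_zsmul, Finset.sum_add_distrib, ← hc, ← hd]
    simp only [sr, ← hn]; abel
  have e2 := Δ_coeff_unique e1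
  have e3 : g = (c b : ℤ) • b := by
    rw [natCast_zsmul]
    conv_lhs => rw [hc]
    apply Finset.sum_eq_single_of_mem b hb
    intro x hx hxb
    have := e2 x hx
    simp only [hxb, if_false] at this
    have : c x = 0 := by omega
    simp [this]
  have := D.reduced b (Δ_R hb) (c b) (e3 ▸ hgR)
  have h1 : (c b : ℤ) = 1 := by omega
  rw [h1, one_smul] at e3
  exact hne e3

variable (D) in
/-- action of a word of reflections -/
def act (L : List X) (x : X) : X := L.foldr (fun a y => D.sr a y) x

@[simp] theorem act_nil (x : X) : D.act [] x = x := rfl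
@[simp] theorem act_cons (a : X) (L : List X) (x : X) : D.act (a :: L) x = D.sr a (D.act L x) := rfl
theorem act_append (L M : List X) (x : X) : D.act (L ++ M) x = D.act L (D.act M x) := by
  simp [act, List.foldr_append]

theorem act_mem {L : List X} (hL : ∀ a ∈ L, a ∈ D.R) {x : X} (hx : x ∈ D.R) : D.act L x ∈ D.R := by
  induction L with
  | nil => exact hx
  | cons a L ih => simp only [List.forall_mem_cons] at hL; exact sr_mem hL.1 (ih hL.2)

theorem act_reverse {L : List X} (hL : ∀ a ∈ L, a ∈ D.R) (x : X) :
    D.act L.reverse (D.act L x) = x := by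
  induction L generalizing x with
  | nil => rfl
  | cons a L ih =>
    simp only [List.forall_mem_cons] at hL
    simp only [List.reverse_cons, act_append, act_cons, act_nil, sr_sr hL.1, ih hL.2]

section
variable [Module.Free ℤ X] [Module.Finite ℤ X]

theorem pair_act {L : List X} (hL : ∀ a ∈ L, a ∈ D.R) {a : X} (ha : a ∈ D.R) (x : X) :
    D.pair (D.act L x) (D.coroot a) = D.pair x (D.coroot (D.act L.reverse a)) := by
  induction L generalizing a with
  | nil => rfl
  | cons b L ih =>
    simp only [List.forall_mem_cons] at hL
    rw [act_cons, pair_sr ha hL.1, ih hL.2 (sr_mem hL.1 ha)]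
    simp only [List.reverse_cons, act_append, act_cons, act_nil]

theorem exchange {L : List X} (hL : ∀ a ∈ L, a ∈ D.Δ) {g : X} (hg : g ∈ D.Rpos)
    (hneg : -(D.act L.reverse g) ∈ D.Rpos) :
    ∃ M : List X, (∀ a ∈ M, a ∈ D.Δ) ∧ M.length < L.length ∧
      ∀ x, D.sr g (D.act L x) = D.act M x := by
  induction L generalizing g with
  | nil => exact absurd hneg (D.not_pos_and_neg g hg)
  | cons b L ih =>
    simp only [List.forall_mem_cons] at hL
    have hbR := Δ_R hL.1
    by_cases hgb : g = b
    · subst hgb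
      exact ⟨L, hL.2, by simp, fun x => by rw [act_cons, sr_sr hbR]⟩
    · simp only [List.reverse_cons, act_append, act_cons, act_nil] at hneg
      obtain ⟨M, hM, hlen, hx⟩ := ih hL.2 (sr_pos hg hL.1 hgb) hneg
      refine ⟨b :: M, by simpa using ⟨hL.1, hM⟩, by simpa using hlen, fun x => ?_⟩
      rw [act_cons, act_cons, ← hx, sr_conj (D.Rpos_subset hg) hbR, sr_sr hbR]

/-- for dominant `m`, every simple word sends `m` to something below `m` -/
theorem act_le {m : X} (hm : m ∈ D.Xplus) : ∀ (n : ℕ) (L : List X), L.length ≤ n →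
    (∀ a ∈ L, a ∈ D.Δ) → ∃ c : X → ℕ, m - D.act L m = ∑ b ∈ D.Δ, c b • b := by
  classical
  intro n
  induction n with
  | zero =>
    intro L hn _
    have : L = [] := by simpa using hn
    subst this
    exact ⟨0, by simp⟩
  | succ n ih =>
    intro L hn hL
    cases L with
    | nil => exact ⟨0, by simp⟩
    | cons b L =>
      simp only [List.forall_mem_cons] at hL
      have hbR := Δ_R hL.1
      have hLR : ∀ a ∈ L, a ∈ D.R := fun a ha => Δ_R (hL.2 a ha)
      have hlen : L.length ≤ n := by simpa using hn
      have hrev : D.act L.reverse b ∈ D.R := act_mem (by simpa using hLR) hbR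
      rcases D.pos_or_neg _ hrev with h | h
      · have hp := hm _ h
        rw [← pair_act hLR hbR] at hp
        obtain ⟨c, hc⟩ := ih L hlen hL.2
        refine ⟨fun x => c x + if x = b then (D.pair (D.act L m) (D.coroot b)).toNat else 0, ?_⟩
        simp only [add_smul, Finset.sum_add_distrib, ← hc, ite_smul, zero_smul,
          Finset.sum_ite_eq', hL.1, if_true]
        rw [act_cons, sr, ← natCast_zsmul, Int.toNat_of_nonneg hp]
        abel
      · obtain ⟨M, hM, hlt, hx⟩ := exchange hL.2 (D.Δ_subset hL.1) h
        rw [act_cons, hx]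
        exact ih M (by omega) hM

/-- reflections are words in simple reflections -/
theorem sr_word_pos : ∀ (n : ℕ) (g : X), g ∈ D.Rpos → ∀ c : X → ℕ, g = ∑ b ∈ D.Δ, c b • b →
    ∑ b ∈ D.Δ, c b ≤ n → ∃ L : List X, (∀ a ∈ L, a ∈ D.Δ) ∧ ∀ x, D.sr g x = D.act L x := by
  classical
  intro n
  induction n with
  | zero =>
    intro g hg c hc hn
    have h0 : ∀ b ∈ D.Δ, c b = 0 := by simpa using hn
    have : g = 0 := by
      rw [hc]; exact Finset.sum_eq_zero fun b hb => by simp [h0 b hb]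
    subst this
    exact absurd (by simpa using hg) (D.not_pos_and_neg 0 hg)
  | succ n ih =>
    intro g hg c hc hn
    have hgR := D.Rpos_subset hg
    by_cases hgΔ : g ∈ D.Δ
    · exact ⟨[g], by simpa using hgΔ, fun x => rfl⟩
    obtain ⟨b, hb, hpos⟩ := D.mathlib_facts.2.1 g hg
    have hne : g ≠ b := fun h => hgΔ (h ▸ hb)
    have hp := sr_pos hg hb hne
    obtain ⟨d, hd⟩ := D.pos_eq_nat_comb _ hp
    have e1 : ∑ x ∈ D.Δ, (d x : ℤ) • x =
        ∑ x ∈ D.Δ, (c x - if x = b then D.pair g (D.coroot b) else 0 : ℤ) • x := by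
      simp only [sub_smul, natCast_zsmul, Finset.sum_sub_distrib, ← hc, ← hd, ite_smul, zero_smul,
        Finset.sum_ite_eq', hb, if_true]
      rfl
    have e2 := Δ_coeff_unique e1
    have e3 : ∑ x ∈ D.Δ, (d x : ℤ) = ∑ x ∈ D.Δ, (c x : ℤ) - D.pair g (D.coroot b) := by
      rw [Finset.sum_congr rfl e2]
      simp [Finset.sum_sub_distrib, hb]
    have e4 : ∑ x ∈ D.Δ, d x ≤ n := by
      zify at hn ⊢; omega
    obtain ⟨L, hL, hx⟩ := ih _ hp d hd e4
    refine ⟨b :: (L ++ [b]), ?_, fun x => ?_⟩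
    · simp only [List.forall_mem_cons, List.mem_append, List.mem_singleton]
      refine ⟨hb, ?_⟩
      rintro a (ha | rfl)
      · exact hL a ha
      · exact hb
    · rw [act_cons, act_append, ← hx, sr_conj hgR (Δ_R hb), sr_sr (Δ_R hb)]
      simp only [act_cons, act_nil]
      rw [sr_sr (Δ_R hb)]

theorem sr_word {g : X} (hg : g ∈ D.R) :
    ∃ L : List X, (∀ a ∈ L, a ∈ D.Δ) ∧ ∀ x, D.sr g x = D.act L x := by
  rcases D.pos_or_neg g hg with h | h
  · obtain ⟨c, hc⟩ := D.pos_eq_nat_comb _ h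
    exact sr_word_pos _ g h c hc le_rfl
  · obtain ⟨c, hc⟩ := D.pos_eq_nat_comb _ h
    obtain ⟨L, hL, hx⟩ := sr_word_pos _ _ h c hc le_rfl
    exact ⟨L, hL, fun x => by rw [← hx, sr_neg_left hg]⟩

theorem weyl_word {w : X ≃ₗ[ℤ] X} (hw : w ∈ D.Weyl) :
    ∃ L : List X, (∀ a ∈ L, a ∈ D.Δ) ∧ ∀ x, w x = D.act L x := by
  induction hw using Subgroup.closure_induction with
  | mem w h =>
    obtain ⟨a, ha, hx⟩ := h
    obtain ⟨L, hL, hx'⟩ := sr_word ha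
    exact ⟨L, hL, fun x => by rw [hx, ← hx']; rfl⟩
  | one => exact ⟨[], by simp, fun x => rfl⟩
  | mul u v _ _ hu hv =>
    obtain ⟨L, hL, hx⟩ := hu
    obtain ⟨M, hM, hy⟩ := hv
    refine ⟨L ++ M, ?_, fun x => ?_⟩
    · intro a ha
      rcases List.mem_append.mp ha with h | h
      · exact hL a h
      · exact hM a h
    · rw [act_append, ← hy, ← hx]; rfl
  | inv u _ hu =>
    obtain ⟨L, hL, hx⟩ := hu
    refine ⟨L.reverse, by simpa using hL, fun x => ?_⟩
    have h := act_reverse (fun a ha => Δ_R (hL a ha)) (u⁻¹ x)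
    rw [← hx] at h
    have h2 : u (u⁻¹ x) = x := u.apply_symm_apply x
    rw [h2] at h
    exact h.symm

theorem weyl_le {m : X} (hm : m ∈ D.Xplus) {w : X ≃ₗ[ℤ] X} (hw : w ∈ D.Weyl) :
    ∃ c : X → ℕ, m - w m = ∑ b ∈ D.Δ, c b • b := by
  obtain ⟨L, hL, hx⟩ := weyl_word hw
  rw [hx]
  exact act_le hm _ L le_rfl hL

theorem act_sub_mem {L : List X} (hL : ∀ a ∈ L, a ∈ D.R) (x : X) :
    D.act L x - x ∈ Submodule.span ℤ (D.R : Set X) := by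
  induction L with
  | nil => simp
  | cons a L ih =>
    simp only [List.forall_mem_cons] at hL
    have h1 := ih hL.2
    have : D.act (a :: L) x - x = (D.act L x - x) - D.pair (D.act L x) (D.coroot a) • a := by
      rw [act_cons, sr]; abel
    rw [this]
    exact Submodule.sub_mem _ h1 (Submodule.smul_mem _ _ (Submodule.subset_span hL.1))

theorem orbit_finite (x : X) : (D.WOrbit x).Finite := by
  let F : X → ({a // a ∈ D.R} → ℤ) := fun v a => D.pair v (D.coroot a.1)
  let T : Set ({a // a ∈ D.R} → ℤ) :=
    Set.pi Set.univ (fun _ => ((fun g => D.pair x (D.coroot g)) '' (D.R : Set X)))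
  have hT : T.Finite := Set.Finite.pi fun _ => D.R.finite_toSet.image _
  refine Set.Finite.of_finite_image (f := F) (hT.subset ?_) ?_
  · rintro - ⟨v, ⟨w, hw, rfl⟩, rfl⟩ a -
    obtain ⟨L, hL, hx⟩ := weyl_word hw
    have hLR : ∀ a ∈ L, a ∈ D.R := fun a ha => Δ_R (hL a ha)
    refine ⟨D.act L.reverse a.1, act_mem (by simpa using hLR) a.2, ?_⟩
    simp only [F]
    rw [hx, pair_act hLR a.2]
  · rintro v ⟨w, hw, rfl⟩ v' ⟨w', hw', rfl⟩ h
    obtain ⟨L, hL, hx⟩ := weyl_word hw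
    obtain ⟨L', hL', hx'⟩ := weyl_word hw'
    have h1 := act_sub_mem (fun a ha => Δ_R (hL a ha)) x
    have h2 := act_sub_mem (fun a ha => Δ_R (hL' a ha)) x
    rw [← hx] at h1
    rw [← hx'] at h2
    have h3 := Submodule.sub_mem _ h1 h2
    rw [sub_sub_sub_cancel_right] at h3
    refine sub_eq_zero.mp (D.mathlib_facts.2.2 _ h3 fun g hg => ?_)
    have := congrFun h ⟨g, hg⟩
    simp only [F] at this
    rw [map_sub, LinearMap.sub_apply, this, sub_self]

end

/-- the reflection as a linear equivalence lies in the Weyl group -/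
theorem exists_refl {a : X} (ha : a ∈ D.R) : ∃ w ∈ D.Weyl, ∀ x, w x = D.sr a x := by
  refine ⟨{ toFun := D.sr a, invFun := D.sr a, left_inv := sr_sr ha, right_inv := sr_sr ha
            map_add' := fun x y => ?_, map_smul' := fun n x => ?_ },
    Subgroup.subset_closure ⟨a, ha, fun x => rfl⟩, fun x => rfl⟩
  · simp only [sr, map_add, LinearMap.add_apply]; module
  · simp only [sr, map_smul, LinearMap.smul_apply, RingHom.id_apply, smul_eq_mul]; module

theorem exists_rho : ∃ r : X, ∀ b ∈ D.Δ, 0 < D.pair r (D.coroot b) := by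
  classical
  refine ⟨∑ g ∈ D.Rpos, g, fun b hb => ?_⟩
  have hbp := D.Δ_subset hb
  have hbR := Δ_R hb
  rw [← Finset.add_sum_erase _ _ hbp, map_add, LinearMap.add_apply, D.pair_self b hbR]
  have hinv : ∀ g ∈ D.Rpos.erase b, D.sr b g ∈ D.Rpos.erase b := by
    intro g hg
    obtain ⟨h1, h2⟩ := Finset.mem_erase.mp hg
    refine Finset.mem_erase.mpr ⟨fun h => ?_, sr_pos h2 hb h1⟩
    have h3 := sr_sr hbR g
    rw [h, sr_self hbR] at h3
    exact D.not_pos_and_neg b hbp (h3 ▸ h2)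
  have hs : ∑ g ∈ D.Rpos.erase b, D.pair g (D.coroot b) =
      ∑ g ∈ D.Rpos.erase b, -D.pair g (D.coroot b) := by
    refine Finset.sum_bij' (fun g _ => D.sr b g) (fun g _ => D.sr b g) hinv hinv
      (fun g _ => sr_sr hbR g) (fun g _ => sr_sr hbR g) (fun g _ => ?_)
    simp only [sr, map_sub, map_smul, LinearMap.sub_apply, LinearMap.smul_apply,
      D.pair_self b hbR, smul_eq_mul]
    ring
  rw [map_sum, LinearMap.sum_apply]
  rw [Finset.sum_neg_distrib] at hs
  omega

/-- separation of a point from the convex hull of a finite set in a finite-dimensional space -/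
theorem separate {E : Type} [AddCommGroup E] [Module ℝ E] [FiniteDimensional ℝ E] {S : Set E}
    (hS : S.Finite) {p : E} (hp : p ∉ convexHull ℝ S) :
    ∃ f : E →ₗ[ℝ] ℝ, ∀ s ∈ S, f s < f p := by
  let e : E ≃ₗ[ℝ] (Fin (Module.finrank ℝ E) → ℝ) := (Module.finBasis ℝ E).equivFun
  have h1 : e p ∉ convexHull ℝ (e '' S) := by
    intro h
    have h2 := LinearMap.image_convexHull (e : E →ₗ[ℝ] (Fin (Module.finrank ℝ E) → ℝ)) S
    simp only [LinearEquiv.coe_coe] at h2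
    rw [← h2] at h
    obtain ⟨q, hq, hqe⟩ := h
    exact hp (e.injective hqe ▸ hq)
  obtain ⟨f, u, hu1, hu2⟩ := geometric_hahn_banach_closed_point (convex_convexHull ℝ (e '' S))
    ((hS.image e).isClosed_convexHull ℝ) h1
  refine ⟨f.toLinearMap ∘ₗ e.toLinearMap, fun s hs => ?_⟩
  exact (hu1 (e s) (subset_convexHull ℝ _ ⟨s, hs, rfl⟩)).trans hu2

end helpers

end RootDatumBase

/-- Proposition B.3 (i) ⇔ (ii). For dominant `λ, μ ∈ X₊`:
`λ ⪯ μ` iff `Conv(Wλ) ⊆ Conv(Wμ)` in `X ⊗ ℝ`. -/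
theorem weak_order_iff_convexHull_subset
    {X Xv : Type} [AddCommGroup X] [AddCommGroup Xv]
    [Module.Free ℤ X] [Module.Finite ℤ X]
    (D : RootDatumBase X Xv)
    (l m : X) (hl : l ∈ D.Xplus) (hm : m ∈ D.Xplus) :
    D.dpreceq l m ↔ D.ConvW l ⊆ D.ConvW m := by
  open RootDatumBase in
  constructor
  · rintro ⟨c, hc0, hc⟩
    refine convexHull_min ?_ (convex_convexHull ℝ _)
    rintro - ⟨-, ⟨w1, hw1, rfl⟩, rfl⟩
    by_contra hcon
    obtain ⟨f, hf⟩ := separate ((orbit_finite m).image _) hcon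
    obtain ⟨r, hr⟩ := exists_rho (D := D)
    obtain ⟨v, ⟨w, hw, rfl⟩, hmax⟩ := Set.exists_max_image (D.WOrbit r) (fun x => f (toReal X x))
      (orbit_finite r) ⟨r, 1, D.Weyl.one_mem, rfl⟩
    have hpos : ∀ b ∈ D.Δ, 0 ≤ f (toReal X (w b)) := by
      intro b hb
      obtain ⟨s, hs, hsx⟩ := exists_refl (Δ_R hb)
      have h := hmax (w (s r)) ⟨w * s, D.Weyl.mul_mem hw hs, rfl⟩
      simp only [hsx, sr, map_sub, map_smul, map_zsmul] at h
      have h2 : (0 : ℝ) < (D.pair r (D.coroot b) : ℤ) := by exact_mod_cast hr b hb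
      rw [zsmul_eq_mul] at h
      by_contra! h3
      nlinarith
    -- step 1
    have s1 : f (toReal X (w1 l)) ≤ f (toReal X (w l)) := by
      obtain ⟨d, hd⟩ := weyl_le hl (D.Weyl.mul_mem (D.Weyl.inv_mem hw) hw1)
      have e1 : w l - w1 l = w (l - (w⁻¹ * w1) l) := by
        rw [map_sub]
        congr 1
        exact (w.apply_symm_apply (w1 l)).symm
      have e2 : f (toReal X (w l)) - f (toReal X (w1 l)) =
          ∑ b ∈ D.Δ, (d b : ℝ) * f (toReal X (w b)) := by
        rw [← map_sub, ← map_sub, e1, hd]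
        simp [map_sum, map_nsmul]
      have : 0 ≤ ∑ b ∈ D.Δ, (d b : ℝ) * f (toReal X (w b)) :=
        Finset.sum_nonneg fun b hb => mul_nonneg (by positivity) (hpos b hb)
      linarith
    have s2 : f (toReal X (w l)) ≤ f (toReal X (w m)) := by
      have hbc : ∀ x, LinearMap.baseChange ℝ (w : X →ₗ[ℤ] X) (toReal X x) = toReal X (w x) := by
        intro x; exact LinearMap.baseChange_tmul _ _ _
      have e := congrArg (fun y => f (LinearMap.baseChange ℝ (w : X →ₗ[ℤ] X) y)) hc
      simp only [map_sum, map_smul, hbc, smul_eq_mul, map_sub] at e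
      have : 0 ≤ ∑ b ∈ D.Δ, c b * f (toReal X (w b)) :=
        Finset.sum_nonneg fun b hb => mul_nonneg (hc0 b) (hpos b hb)
      linarith
    have s3 := hf _ ⟨w m, ⟨w, hw, rfl⟩, rfl⟩
    linarith
  · intro h
    have h1 : toReal X l ∈ D.ConvW m :=
      h (subset_convexHull ℝ _ ⟨l, ⟨1, D.Weyl.one_mem, rfl⟩, rfl⟩)
    let S : Set (ℝ ⊗[ℤ] X) := {v | ∃ c : X → ℝ, (∀ b, 0 ≤ c b) ∧
      toReal X m - v = ∑ b ∈ D.Δ, c b • toReal X b}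
    have hS : Convex ℝ S := by
      rintro x ⟨c, hc0, hc⟩ y ⟨d, hd0, hd⟩ s t hs ht hst
      refine ⟨fun b => s * c b + t * d b, fun b =>
        add_nonneg (mul_nonneg hs (hc0 b)) (mul_nonneg ht (hd0 b)), ?_⟩
      simp only [add_smul, mul_smul, Finset.sum_add_distrib, ← Finset.smul_sum, ← hc, ← hd]
      have : toReal X m = (s + t) • toReal X m := by rw [hst, one_smul]
      conv_lhs => rw [this]
      module
    have h2 : D.ConvW m ⊆ S := by
      refine convexHull_min ?_ hS
      rintro - ⟨-, ⟨w, hw, rfl⟩, rfl⟩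
      obtain ⟨d, hd⟩ := weyl_le hm hw
      refine ⟨fun b => d b, fun b => by positivity, ?_⟩
      rw [← map_sub, hd, map_sum]
      simp only [map_nsmul, Nat.cast_smul_eq_nsmul]
    obtain ⟨c, hc0, hc⟩ := h2 h1
    exact ⟨c, hc0, by rw [map_sub, hc]⟩
end

section
/- Let λ, μ, ν ∈ X. If the inequality kλ ≤ kμ + ν holds for infinitely many natural numbers k, then λ ⪯ μ, i.e. (μ − λ) ⊗ 1 is a nonnegative real combination of simple roots in X ⊗ ℝ. -/
open scoped TensorProduct

theorem RootDatumBase.exists_nat_comb {X Xv : Type} [AddCommGroup X] [AddCommGroup Xv]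
    (D : RootDatumBase X Xv) (x : X) (hx : x ∈ D.Qplus) :
    ∃ c : X → ℕ, x = ∑ β ∈ D.Δ, c β • β := by
  unfold RootDatumBase.Qplus at hx
  induction hx using AddSubmonoid.closure_induction with
  | mem x hx => exact D.pos_eq_nat_comb x hx
  | zero => exact ⟨0, by simp⟩
  | add x y _ _ hx hy =>
    obtain ⟨c, rfl⟩ := hx
    obtain ⟨d, rfl⟩ := hy
    exact ⟨c + d, by simp [add_smul, Finset.sum_add_distrib]⟩

theorem RootDatumBase.coeff_zero {X Xv : Type} [AddCommGroup X] [AddCommGroup Xv]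
    (D : RootDatumBase X Xv) (c : X → ℤ) (hc : ∑ β ∈ D.Δ, c β • β = 0) :
    ∀ β ∈ D.Δ, c β = 0 := by
  intro β hβ
  have h := Fintype.linearIndependent_iff.mp D.simple_indep (fun a => c a.1) (by
    rw [← hc]
    exact Finset.sum_coe_sort D.Δ (fun b => c b • b)) ⟨β, hβ⟩
  exact h

/-- If `kλ ≤ kμ + ν` holds for infinitely many `k ∈ ℕ`,
then `λ ⪯ μ`. -/
theorem weak_order_of_frequently_le
    {X Xv : Type} [AddCommGroup X] [AddCommGroup Xv]
    [Module.Free ℤ X] [Module.Finite ℤ X]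
    (D : RootDatumBase X Xv) (l m n : X)
    (h : {k : ℕ | D.dle (k • l) (k • m + n)}.Infinite) :
    D.dpreceq l m := by
  have key : ∀ k ∈ {k : ℕ | D.dle (k • l) (k • m + n)}, ∃ c : X → ℕ,
      (k : ℤ) • (m - l) + n = ∑ β ∈ D.Δ, (c β : ℤ) • β := by
    intro k hk
    obtain ⟨c, hc⟩ := D.exists_nat_comb _ hk
    refine ⟨c, ?_⟩
    simp only [natCast_zsmul]
    rw [← hc, smul_sub]
    abel
  obtain ⟨k0, hk0⟩ := h.nonempty
  obtain ⟨k1, hk1, h01⟩ := h.exists_gt k0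
  obtain ⟨c0, hc0⟩ := key k0 hk0
  obtain ⟨c1, hc1⟩ := key k1 hk1
  have hd : ((k1 : ℤ) - k0) • (m - l) = ∑ β ∈ D.Δ, ((c1 β : ℤ) - c0 β) • β := by
    simp only [sub_smul _ _ (_ : X), Finset.sum_sub_distrib]
    rw [← hc0, ← hc1]
    abel
  have hle : ∀ β ∈ D.Δ, c0 β ≤ c1 β := by
    intro β hβ
    by_contra hlt
    obtain ⟨k, hk, hkk⟩ := h.exists_gt (k0 + (k1 - k0) * c0 β)
    obtain ⟨c, hc⟩ := key k hk
    have hd' : ((k : ℤ) - k0) • (m - l) = ∑ β ∈ D.Δ, ((c β : ℤ) - c0 β) • β := by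
      simp only [sub_smul _ _ (_ : X), Finset.sum_sub_distrib]
      rw [← hc0, ← hc]
      abel
    have hz := D.coeff_zero
      (fun β => ((k : ℤ) - k0) * ((c1 β : ℤ) - c0 β) - ((k1 : ℤ) - k0) * ((c β : ℤ) - c0 β)) (by
        simp only [sub_smul _ _ (_ : X), Finset.sum_sub_distrib, mul_smul, ← Finset.smul_sum]
        simp only [sub_smul _ _ (_ : X), Finset.sum_sub_distrib] at hd hd'
        rw [← hd, ← hd']
        module) β hβ
    zify [h01.le] at hkk hlt h01
    have hcn : (0 : ℤ) ≤ c β := by positivity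
    have h0n : (0 : ℤ) ≤ c0 β := by positivity
    have a1 : (0 : ℤ) < (k1 : ℤ) - k0 := by linarith
    have a2 : (0 : ℤ) < (k : ℤ) - k0 := by nlinarith
    have a3 : (c1 β : ℤ) - c0 β ≤ -1 := by omega
    nlinarith
  have hpos : (0 : ℝ) < (k1 : ℝ) - k0 := by
    have : (k0 : ℝ) < k1 := by exact_mod_cast h01
    linarith
  refine ⟨fun β => max 0 (((k1 : ℝ) - k0)⁻¹ * ((c1 β : ℝ) - c0 β)), fun β => le_max_left _ _, ?_⟩
  have hsum : ∑ β ∈ D.Δ, max 0 (((k1 : ℝ) - k0)⁻¹ * ((c1 β : ℝ) - c0 β)) •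
      RootDatumBase.toReal X β
      = ((k1 : ℝ) - k0)⁻¹ • ∑ β ∈ D.Δ, ((c1 β : ℝ) - c0 β) • RootDatumBase.toReal X β := by
    rw [Finset.smul_sum]
    refine Finset.sum_congr rfl fun β hβ => ?_
    have h1 : (c0 β : ℝ) ≤ c1 β := by exact_mod_cast hle β hβ
    rw [max_eq_right (mul_nonneg (inv_nonneg.mpr hpos.le) (by linarith)), mul_smul]
  have hT := congrArg (RootDatumBase.toReal X) hd
  simp only [map_sum, map_zsmul] at hT
  have hT' : ((k1 : ℝ) - k0) • RootDatumBase.toReal X (m - l)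
      = ∑ β ∈ D.Δ, ((c1 β : ℝ) - c0 β) • RootDatumBase.toReal X β := by
    have e : ∀ (z : ℤ) (v : ℝ ⊗[ℤ] X), z • v = (z : ℝ) • v := fun z v =>
      (Int.cast_smul_eq_zsmul ℝ z v).symm
    simp only [e] at hT
    push_cast at hT
    exact hT
  rw [hsum, ← hT', smul_smul, inv_mul_cancel₀ hpos.ne', one_smul]
end
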